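/- Assume Ψ satisfies the SOSC with feasible open set O, let s be the similarity dimension, let μ be the natural measure, and assume μ(∂O) = 0 and that μ gives zero measure to every sphere in ℝⁿ (known properties under the SOSC). Let Ê be the set of points of E with dense shift orbit. Then μ(E ∖ Ê) = 0, Ê ⊆ O, and for every y ∈ Ê: Spec(μ, y) = Spec(μ, Ê) = Spec(μ, O ∩ E). -/

import Mathlib

open MeasureTheory Filter Topology
open scoped ENNReal

noncomputable section

/-- `f` is a similarity of ratio `r`. -/
def IsSimilarityRatio {X : Type*} [MetricSpace X] (f : X → X) (r : ℝ) : Prop :=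
  ∀ x y, dist (f x) (f y) = r * dist x y

/-- The composition `f_{i₁} ∘ ⋯ ∘ f_{i_k}` associated with a finite word. -/
def wordMap {X : Type*} {m : ℕ} (f : Fin m → X → X) : List (Fin m) → X → X
  | [] => id
  | j :: l => f j ∘ wordMap f l

/-- The set `Ê` of points of `E` with dense shift orbit. -/
def denseOrbitSet {X : Type*} {m : ℕ} [TopologicalSpace X]
    (f : Fin m → X → X) (E : Set X) : Set X :=
  {y | y ∈ E ∧ E ⊆ closure {w | w ∈ E ∧ ∃ l : List (Fin m), l ≠ [] ∧ wordMap f l w = y}}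

/-- The `s`-density `θ_μ^s(x, d) = μ(B(x,d)) / (2d)^s` of the closed ball `B(x, d)`. -/
def sdens {n : ℕ} (μ : Measure (EuclideanSpace ℝ (Fin n))) (s : ℝ)
    (x : EuclideanSpace ℝ (Fin n)) (d : ℝ) : ℝ≥0∞ :=
  μ (Metric.closedBall x d) / ENNReal.ofReal ((2 * d) ^ s)

/-- The asymptotic spectrum `Spec(μ, x)`. -/
def specAt {n : ℕ} (μ : Measure (EuclideanSpace ℝ (Fin n))) (s : ℝ)
    (x : EuclideanSpace ℝ (Fin n)) : Set ℝ≥0∞ :=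
  {L | ∃ d : ℕ → ℝ, (∀ k, 0 < d k) ∧ Tendsto d atTop (nhds 0) ∧
    Tendsto (fun k => sdens μ s x (d k)) atTop (nhds L)}

/-- The ratio of the similarity `wordMap f l`. -/
def wordRatio {m : ℕ} (r : Fin m → ℝ) (l : List (Fin m)) : ℝ := (l.map r).prod

lemma IsSimilarityRatio.continuous {X : Type*} [MetricSpace X] {f : X → X} {r : ℝ}
    (h : IsSimilarityRatio f r) : Continuous f :=
  (LipschitzWith.of_dist_le_mul (K := r.toNNReal) fun x y => by
    rw [h x y]
    exact mul_le_mul_of_nonneg_right (Real.le_coe_toNNReal r) dist_nonneg).continuous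

lemma IsSimilarityRatio.injective {X : Type*} [MetricSpace X] {f : X → X} {r : ℝ}
    (h : IsSimilarityRatio f r) (hr : 0 < r) : Function.Injective f := fun x y hxy => by
  have h0 := h x y
  rw [hxy, dist_self, eq_comm, mul_eq_zero] at h0
  exact dist_eq_zero.1 (h0.resolve_left hr.ne')

lemma IsSimilarityRatio.surjective {V : Type*} [NormedAddCommGroup V] [InnerProductSpace ℝ V]
    [FiniteDimensional ℝ V] {f : V → V} {r : ℝ} (h : IsSimilarityRatio f r) (hr : 0 < r) :
    Function.Surjective f := by
  have hg : Isometry fun x => r⁻¹ • f x := Isometry.of_dist_eq fun x y => by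
    rw [dist_smul₀, h x y, Real.norm_of_nonneg (inv_pos.2 hr).le, inv_mul_cancel_left₀ hr.ne']
  let g := hg.affineIsometryOfStrictConvexSpace
  have hsurj : Function.Surjective g :=
    g.toAffineMap.linear_surjective_iff.1
      (LinearMap.injective_iff_surjective.1 (g.toAffineMap.linear_injective_iff.2 g.injective))
  intro y
  obtain ⟨x, hx⟩ := hsurj (r⁻¹ • y)
  exact ⟨x, smul_right_injective V (inv_ne_zero hr.ne') hx⟩

lemma IsSimilarityRatio.image_closedBall {V : Type*} [NormedAddCommGroup V]
    [InnerProductSpace ℝ V] [FiniteDimensional ℝ V] {f : V → V} {r : ℝ}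
    (h : IsSimilarityRatio f r) (hr : 0 < r) (x : V) (d : ℝ) :
    f '' Metric.closedBall x d = Metric.closedBall (f x) (r * d) := by
  ext z
  obtain ⟨w, rfl⟩ := h.surjective hr z
  rw [(h.injective hr).mem_set_image, Metric.mem_closedBall, Metric.mem_closedBall, h w x,
    mul_le_mul_iff_right₀ hr]

lemma wordMap_append {X : Type*} {m : ℕ} (f : Fin m → X → X) (l l' : List (Fin m)) (x : X) :
    wordMap f (l ++ l') x = wordMap f l (wordMap f l' x) := by
  induction l with
  | nil => rfl
  | cons i l ih => simp [wordMap, ih]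

lemma wordRatio_pos {m : ℕ} {r : Fin m → ℝ} (hr : ∀ i, 0 < r i) (l : List (Fin m)) :
    0 < wordRatio r l :=
  List.prod_pos fun a ha => by
    obtain ⟨i, -, rfl⟩ := List.mem_map.1 ha
    exact hr i

lemma wordRatio_le_pow {m : ℕ} {r : Fin m → ℝ} (hr : ∀ i, 0 < r i) {c : ℝ} (hc : 0 ≤ c)
    (h : ∀ i, r i ≤ c) (l : List (Fin m)) : wordRatio r l ≤ c ^ l.length := by
  induction l with
  | nil => simp [wordRatio]
  | cons i l ih =>
    simp only [wordRatio, List.map_cons, List.prod_cons, List.length_cons, pow_succ'] at ih ⊢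
    exact mul_le_mul (h i) ih (wordRatio_pos hr l).le hc

lemma isSimilarityRatio_wordMap {X : Type*} [MetricSpace X] {m : ℕ} {f : Fin m → X → X}
    {r : Fin m → ℝ} (h : ∀ i, IsSimilarityRatio (f i) (r i)) (l : List (Fin m)) :
    IsSimilarityRatio (wordMap f l) (wordRatio r l) := by
  induction l with
  | nil => intro x y; simp [wordMap, wordRatio]
  | cons i l ih =>
    intro x y
    simp only [wordMap, Function.comp_apply, h i _ _, ih x y, wordRatio, List.map_cons,
      List.prod_cons, mul_assoc]

lemma wordMap_mem {X : Type*} {m : ℕ} {f : Fin m → X → X} {A : Set X}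
    (h : ∀ i, f i '' A ⊆ A) (l : List (Fin m)) {x : X} (hx : x ∈ A) : wordMap f l x ∈ A := by
  induction l with
  | nil => exact hx
  | cons i l ih => exact h i ⟨_, ih, rfl⟩

lemma exists_word_length_eq_mem_image {X : Type*} {m : ℕ} {f : Fin m → X → X} {E : Set X}
    (hE : E = ⋃ i, f i '' E) (k : ℕ) {z : X} (hz : z ∈ E) :
    ∃ l : List (Fin m), l.length = k ∧ z ∈ wordMap f l '' E := by
  induction k generalizing z with
  | zero => exact ⟨[], rfl, z, hz, rfl⟩
  | succ k ih =>
    rw [hE] at hz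
    obtain ⟨i, w, hw, rfl⟩ := Set.mem_iUnion.1 hz
    obtain ⟨l, hl, v, hv, rfl⟩ := ih hw
    exact ⟨i :: l, by simp [hl], v, hv, rfl⟩

/-- Cylinder sets of an attractor form arbitrarily small neighbourhoods of each point. -/
lemma exists_word_image_subset {X : Type*} [MetricSpace X] {m : ℕ} {f : Fin m → X → X}
    {r : Fin m → ℝ} (hr : ∀ i, r i ∈ Set.Ioo (0 : ℝ) 1)
    (hsim : ∀ i, IsSimilarityRatio (f i) (r i)) {E : Set X} (hEb : Bornology.IsBounded E)
    (hE : E = ⋃ i, f i '' E) {z : X} (hz : z ∈ E) {U : Set X} (hU : U ∈ 𝓝 z) :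
    ∃ l : List (Fin m), wordMap f l '' E ⊆ U := by
  obtain ⟨ε, hε, hεU⟩ := Metric.mem_nhds_iff.1 hU
  have : Nonempty (Fin m) := by
    rw [hE] at hz
    exact (Set.mem_iUnion.1 hz).nonempty
  obtain ⟨i, hi⟩ := Finite.exists_max r
  obtain ⟨D, hD⟩ := Metric.isBounded_iff.1 hEb
  have hlim : Tendsto (fun k : ℕ => r i ^ k * D) atTop (𝓝 0) := by
    simpa using (tendsto_pow_atTop_nhds_zero_of_lt_one (hr i).1.le (hr i).2).mul_const D
  obtain ⟨k, hk⟩ := (hlim.eventually (gt_mem_nhds hε)).exists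
  obtain ⟨l, hl, w, hw, rfl⟩ := exists_word_length_eq_mem_image hE k hz
  refine ⟨l, ?_⟩
  rintro _ ⟨v, hv, rfl⟩
  apply hεU
  rw [Metric.mem_ball, isSimilarityRatio_wordMap hsim l v w]
  refine lt_of_le_of_lt ?_ hk
  have hle := wordRatio_le_pow (fun j => (hr j).1) (hr i).1.le hi l
  rw [hl] at hle
  exact mul_le_mul hle (hD hv hw) dist_nonneg (pow_nonneg (hr i).1.le k)

lemma denseOrbitSet_subset {X : Type*} {m : ℕ} [TopologicalSpace X] {f : Fin m → X → X}
    {E O : Set X} (hO : IsOpen O) (hOmap : ∀ i, f i '' O ⊆ O) (hOE : (O ∩ E).Nonempty) :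
    denseOrbitSet f E ⊆ O := by
  rintro y ⟨-, hy⟩
  obtain ⟨x, hxO, hxE⟩ := hOE
  obtain ⟨w, hwO, -, l, -, rfl⟩ := mem_closure_iff.1 (hy hxE) O hO hxO
  exact wordMap_mem hOmap l hwO

section SelfSimilarMeasure

variable {X : Type*} [MeasurableSpace X] {m : ℕ} {f : Fin m → X → X} {p : Fin m → ℝ≥0∞}
  {μ : Measure X}

lemma selfSimilar_apply (hf : ∀ i, Measurable (f i)) (hinv : μ = ∑ i, p i • μ.map (f i))
    {S : Set X} (hS : MeasurableSet S) : μ S = ∑ i, p i * μ (f i ⁻¹' S) := by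
  conv_lhs => rw [hinv]
  simp only [Measure.coe_finsetSum, Finset.sum_apply, Measure.smul_apply, smul_eq_mul,
    Measure.map_apply (hf _) hS]

lemma selfSimilar_quasiMeasurePreserving_wordMap (hf : ∀ i, Measurable (f i))
    (hp : ∀ i, p i ≠ 0) (hinv : μ = ∑ i, p i • μ.map (f i)) (l : List (Fin m)) :
    Measure.QuasiMeasurePreserving (wordMap f l) μ μ := by
  induction l with
  | nil => exact Measure.QuasiMeasurePreserving.id μ
  | cons i l ih =>
    refine Measure.QuasiMeasurePreserving.comp ⟨hf i, ?_⟩ ih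
    refine Measure.AbsolutelyContinuous.mk fun S hS h0 => ?_
    rw [selfSimilar_apply hf hinv hS, Finset.sum_eq_zero_iff] at h0
    rw [Measure.map_apply (hf i) hS]
    exact (mul_eq_zero.1 (h0 i (Finset.mem_univ i))).resolve_left (hp i)

/-- A set containing its preimages under all the maps agrees almost everywhere with each of its
preimages under words. -/
lemma selfSimilar_measure_diff_preimage_wordMap [IsFiniteMeasure μ] (hf : ∀ i, Measurable (f i))
    (hp : ∀ i, p i ≠ 0) (hp1 : ∑ i, p i = 1) (hinv : μ = ∑ i, p i • μ.map (f i))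
    {B : Set X} (hB : MeasurableSet B) (hsub : ∀ i, f i ⁻¹' B ⊆ B) (l : List (Fin m)) :
    μ (B \ wordMap f l ⁻¹' B) = 0 := by
  have hstep : ∀ i, μ (B \ f i ⁻¹' B) = 0 := by
    have htot : μ B = μ B + ∑ i, p i * μ (B \ f i ⁻¹' B) := by
      conv_lhs => rw [← one_mul (μ B), ← hp1, Finset.sum_mul]
      conv_rhs => rw [selfSimilar_apply hf hinv hB, ← Finset.sum_add_distrib]
      refine Finset.sum_congr rfl fun i _ => ?_
      rw [← mul_add, ← measure_inter_add_sdiff B (hf i hB), Set.inter_eq_right.2 (hsub i)]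
    have h0 : ∑ i, p i * μ (B \ f i ⁻¹' B) = 0 :=
      (ENNReal.add_right_inj (measure_ne_top μ B)).1 (htot.symm.trans (add_zero _).symm)
    intro i
    exact (mul_eq_zero.1 (Finset.sum_eq_zero_iff.1 h0 i (Finset.mem_univ i))).resolve_left (hp i)
  induction l with
  | nil => simp [wordMap]
  | cons i l ih =>
    have hnull := (selfSimilar_quasiMeasurePreserving_wordMap hf hp hinv l).preimage_null (hstep i)
    refine measure_mono_null (fun x hx => ?_) (measure_union_null ih hnull)
    by_cases h : wordMap f l x ∈ B
    · exact Or.inr ⟨h, hx.2⟩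
    · exact Or.inl ⟨hx.1, h⟩

/-- Almost every point has some shift lying in a prescribed cylinder. -/
lemma selfSimilar_ae_exists_word [IsFiniteMeasure μ] (hf : ∀ i, Measurable (f i))
    (hp : ∀ i, p i ≠ 0) (hp1 : ∑ i, p i = 1) (hinv : μ = ∑ i, p i • μ.map (f i))
    {E : Set X} (hE : μ Eᶜ = 0) (u : List (Fin m))
    (hmeas : ∀ l, MeasurableSet (wordMap f l '' E)) :
    ∀ᵐ y ∂μ, ∃ l, y ∈ wordMap f (l ++ u) '' E := by
  set B : Set X := (⋃ l, wordMap f (l ++ u) '' E)ᶜ with hBdef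
  have hB : MeasurableSet B := (MeasurableSet.iUnion fun l => hmeas _).compl
  have hsub : ∀ i, f i ⁻¹' B ⊆ B := by
    intro i x hx hx'
    obtain ⟨l, w, hw, rfl⟩ := Set.mem_iUnion.1 hx'
    exact hx (Set.mem_iUnion.2 ⟨i :: l, w, hw, rfl⟩)
  have hdiff := selfSimilar_measure_diff_preimage_wordMap hf hp hp1 hinv hB hsub u
  have hpre : μ (wordMap f u ⁻¹' B) = 0 := by
    refine measure_mono_null (t := Eᶜ) (fun x hx hxE => hx ?_) hE
    exact Set.mem_iUnion.2 ⟨[], x, hxE, rfl⟩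
  have hB0 : μ B = 0 := by
    refine measure_mono_null (fun x hx => ?_) (measure_union_null hdiff hpre)
    by_cases h : wordMap f u x ∈ B
    · exact Or.inr h
    · exact Or.inl ⟨hx, h⟩
  refine measure_mono_null (fun y hy => ?_) hB0
  simpa [hBdef] using hy

/-- A self-similar measure concentrated on a set witnessing the open set condition scales exactly
under each word on subsets of that set. -/
lemma selfSimilar_measure_image_wordMap (hf : ∀ i, Measurable (f i))
    (hinj : ∀ i, Function.Injective (f i)) (hinv : μ = ∑ i, p i • μ.map (f i))
    {O : Set X} (hO : μ Oᶜ = 0) (hOmap : ∀ i, f i '' O ⊆ O)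
    (hdisj : ∀ i j, i ≠ j → Disjoint (f i '' O) (f j '' O)) {A : Set X} (hA : A ⊆ O)
    (hmeas : ∀ l, MeasurableSet (wordMap f l '' A)) (l : List (Fin m)) :
    μ (wordMap f l '' A) = (l.map p).prod * μ A := by
  induction l with
  | nil => simp [wordMap]
  | cons i l ih =>
    have himg : wordMap f (i :: l) '' A = f i '' (wordMap f l '' A) := Set.image_comp _ _ _
    rw [selfSimilar_apply hf hinv (hmeas (i :: l)), Finset.sum_eq_single i, himg,
      (hinj i).preimage_image, ih, List.map_cons, List.prod_cons, mul_assoc]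
    · intro j _ hji
      rw [measure_mono_null _ hO, mul_zero]
      rintro x ⟨a, ha, hax⟩ hxO
      exact Set.disjoint_left.1 (hdisj j i hji) ⟨x, hxO, rfl⟩
        (hax ▸ ⟨_, wordMap_mem hOmap l (hA ha), rfl⟩)
    · simp

end SelfSimilarMeasure

/-- Almost every point of a self-similar set has dense shift orbit. -/
lemma measure_diff_denseOrbitSet {X : Type*} [MetricSpace X] [MeasurableSpace X] [BorelSpace X]
    {m : ℕ} {f : Fin m → X → X} {r : Fin m → ℝ} (hr : ∀ i, r i ∈ Set.Ioo (0 : ℝ) 1)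
    (hsim : ∀ i, IsSimilarityRatio (f i) (r i)) {E : Set X} (hEcomp : IsCompact E)
    (hE : E = ⋃ i, f i '' E) {p : Fin m → ℝ≥0∞} (hp : ∀ i, p i ≠ 0) (hp1 : ∑ i, p i = 1)
    {μ : Measure X} [IsFiniteMeasure μ] (hsupp : μ Eᶜ = 0)
    (hinv : μ = ∑ i, p i • μ.map (f i)) : μ (E \ denseOrbitSet f E) = 0 := by
  have hfE : ∀ i, f i '' E ⊆ E := fun i => by
    conv_rhs => rw [hE]
    exact Set.subset_iUnion (fun i => f i '' E) i
  have hae : ∀ᵐ y ∂μ, ∀ u, ∃ l, y ∈ wordMap f (l ++ u) '' E :=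
    ae_all_iff.2 fun u => selfSimilar_ae_exists_word (fun i => (hsim i).continuous.measurable)
      hp hp1 hinv hsupp u fun l =>
        (hEcomp.image (isSimilarityRatio_wordMap hsim l).continuous).measurableSet
  refine measure_mono_null (t := {y | ¬ ∀ u, ∃ l, y ∈ wordMap f (l ++ u) '' E})
    (fun y hy hy' => hy.2 ⟨hy.1, fun z hz => ?_⟩) hae
  refine mem_closure_iff_nhds.2 fun U hU => ?_
  obtain ⟨u, hu⟩ := exists_word_image_subset hr hsim hEcomp.isBounded hE hz hU
  rw [hE] at hz
  obtain ⟨i, -⟩ := Set.mem_iUnion.1 hz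
  obtain ⟨l, w, hw, hwy⟩ := hy' (i :: u)
  refine ⟨wordMap f u w, hu ⟨w, hw, rfl⟩, wordMap_mem hfE u hw, l ++ [i], by simp, ?_⟩
  rw [← wordMap_append, ← hwy, List.append_assoc, List.singleton_append]

lemma continuousAt_measure_closedBall {X : Type*} [MetricSpace X] [MeasurableSpace X]
    [OpensMeasurableSpace X] {μ : Measure X} [IsFiniteMeasure μ] {x : X} {d : ℝ}
    (h : μ (Metric.sphere x d) = 0) :
    ContinuousAt (fun w => μ (Metric.closedBall w d)) x := by
  refine tendsto_measure_of_ae_tendsto_indicator_of_isFiniteMeasure (𝓝 x)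
    Metric.isClosed_closedBall.measurableSet (fun w => Metric.isClosed_closedBall.measurableSet) ?_
  have hne : ∀ᵐ z ∂μ, z ∉ Metric.sphere x d := measure_eq_zero_iff_ae_notMem.1 h
  filter_upwards [hne] with z hz
  have hc : Tendsto (fun w => dist z w) (𝓝 x) (𝓝 (dist z x)) :=
    (continuous_const.dist continuous_id).tendsto x
  rcases lt_or_gt_of_ne (show dist z x ≠ d from hz) with hlt | hgt
  · filter_upwards [hc.eventually (gt_mem_nhds hlt)] with w hw
    simp [Metric.mem_closedBall, hw.le, hlt.le]
  · filter_upwards [hc.eventually (lt_mem_nhds hgt)] with w hw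
    simp [Metric.mem_closedBall, not_le.2 hw, not_le.2 hgt]

lemma mem_specAt_iff_mapClusterPt {n : ℕ} {μ : Measure (EuclideanSpace ℝ (Fin n))} {s : ℝ}
    {x : EuclideanSpace ℝ (Fin n)} {L : ℝ≥0∞} :
    L ∈ specAt μ s x ↔ MapClusterPt L (𝓝[>] (0 : ℝ)) (sdens μ s x) := by
  constructor
  · rintro ⟨d, hd, hd0, hL⟩
    have hd' : Tendsto d atTop (𝓝[>] 0) :=
      tendsto_nhdsWithin_iff.2 ⟨hd0, Eventually.of_forall hd⟩
    exact hL.mapClusterPt.of_comp hd'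
  · intro h
    have hne : (comap (sdens μ s x) (𝓝 L) ⊓ 𝓝[>] (0 : ℝ)).NeBot := by
      rw [MapClusterPt, ClusterPt] at h
      rwa [← map_neBot_iff (sdens μ s x), Filter.push_pull']
    obtain ⟨d, hd⟩ := Filter.exists_seq_tendsto (comap (sdens μ s x) (𝓝 L) ⊓ 𝓝[>] (0 : ℝ))
    obtain ⟨hL, hd0⟩ := tendsto_inf.1 hd
    obtain ⟨hd0, hpos⟩ := tendsto_nhdsWithin_iff.1 hd0
    obtain ⟨N, hN⟩ := eventually_atTop.1 hpos
    exact ⟨fun k => d (k + N), fun k => hN _ (Nat.le_add_left N k),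
      hd0.comp (tendsto_add_atTop_nat N),
      (tendsto_comap_iff.1 hL).comp (tendsto_add_atTop_nat N)⟩

lemma ofReal_wordRatio_rpow {m : ℕ} {r : Fin m → ℝ} (hr : ∀ i, 0 < r i) (s : ℝ)
    (l : List (Fin m)) :
    (l.map fun i => ENNReal.ofReal (r i ^ s)).prod = ENNReal.ofReal (wordRatio r l ^ s) := by
  induction l with
  | nil => simp [wordRatio]
  | cons i l ih =>
    have hl := (wordRatio_pos hr l).le
    simp only [wordRatio, List.map_cons, List.prod_cons] at ih hl ⊢
    rw [ih, Real.mul_rpow (hr i).le hl, ENNReal.ofReal_mul (Real.rpow_nonneg (hr i).le s)]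

section Density

variable {n m : ℕ} {f : Fin m → EuclideanSpace ℝ (Fin n) → EuclideanSpace ℝ (Fin n)}
  {r : Fin m → ℝ} {s : ℝ} {μ : Measure (EuclideanSpace ℝ (Fin n))}
  {O : Set (EuclideanSpace ℝ (Fin n))}

/-- Densities of balls inside the feasible open set are invariant under words. -/
lemma sdens_wordMap (hr : ∀ i, 0 < r i) (hsim : ∀ i, IsSimilarityRatio (f i) (r i))
    (hinv : μ = ∑ i, ENNReal.ofReal ((r i) ^ s) • μ.map (f i)) (hO : μ Oᶜ = 0)
    (hOmap : ∀ i, f i '' O ⊆ O) (hdisj : ∀ i j, i ≠ j → Disjoint (f i '' O) (f j '' O))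
    (l : List (Fin m)) {w : EuclideanSpace ℝ (Fin n)} {d : ℝ} (hd : 0 < d)
    (hw : Metric.closedBall w d ⊆ O) :
    sdens μ s (wordMap f l w) (wordRatio r l * d) = sdens μ s w d := by
  have hpos := wordRatio_pos hr l
  have hppos : 0 < wordRatio r l ^ s := Real.rpow_pos_of_pos hpos s
  have hscale := selfSimilar_measure_image_wordMap (fun i => (hsim i).continuous.measurable)
    (fun i => (hsim i).injective (hr i)) hinv hO hOmap hdisj hw
    (fun l' => ((isCompact_closedBall w d).image
      (isSimilarityRatio_wordMap hsim l').continuous).measurableSet) l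
  rw [(isSimilarityRatio_wordMap hsim l).image_closedBall hpos,
    ofReal_wordRatio_rpow hr] at hscale
  rw [sdens, sdens, hscale, mul_left_comm, Real.mul_rpow hpos.le (by positivity),
    ENNReal.ofReal_mul hppos.le]
  exact ENNReal.mul_div_mul_left _ _ (ENNReal.ofReal_pos.2 hppos).ne' ENNReal.ofReal_ne_top

lemma specAt_subset_of_mem_denseOrbitSet [IsFiniteMeasure μ] (hr : ∀ i, 0 < r i ∧ r i < 1)
    (hsim : ∀ i, IsSimilarityRatio (f i) (r i))
    (hinv : μ = ∑ i, ENNReal.ofReal ((r i) ^ s) • μ.map (f i)) (hO : μ Oᶜ = 0)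
    (hOopen : IsOpen O) (hOmap : ∀ i, f i '' O ⊆ O)
    (hdisj : ∀ i j, i ≠ j → Disjoint (f i '' O) (f j '' O))
    (hsph : ∀ (z : EuclideanSpace ℝ (Fin n)) (ρ : ℝ), μ (Metric.sphere z ρ) = 0)
    {E : Set (EuclideanSpace ℝ (Fin n))} {x y : EuclideanSpace ℝ (Fin n)} (hx : x ∈ O ∩ E)
    (hy : y ∈ denseOrbitSet f E) : specAt μ s x ⊆ specAt μ s y := by
  intro L hL
  rw [mem_specAt_iff_mapClusterPt] at hL ⊢
  obtain ⟨ε, hε, hεO⟩ := Metric.isOpen_iff.1 hOopen x hx.1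
  refine mapClusterPt_iff_frequently.2 fun U hU => ?_
  obtain ⟨V, hVU, hVopen, hLV⟩ := mem_nhds_iff.1 hU
  refine frequently_iff.2 fun {T} hT => ?_
  obtain ⟨δ, hδ, hδT⟩ := mem_nhdsGT_iff_exists_Ioo_subset.1 hT
  have hδ : 0 < δ := hδ
  have hsmall : ∀ᶠ d in 𝓝[>] (0 : ℝ), d ∈ Set.Ioo 0 (min δ (ε / 2)) :=
    Ioo_mem_nhdsGT (lt_min hδ (half_pos hε))
  obtain ⟨d, hdV, hd0, hd⟩ :=
    ((mapClusterPt_iff_frequently.1 hL V (hVopen.mem_nhds hLV)).and_eventually hsmall).exists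
  have hdδ := hd.trans_le (min_le_left _ _)
  have hdε := hd.trans_le (min_le_right _ _)
  have hcont : ContinuousAt (fun w => sdens μ s w d) x :=
    ENNReal.Tendsto.div_const (continuousAt_measure_closedBall (hsph x d))
      (Or.inr (ENNReal.ofReal_pos.2 (Real.rpow_pos_of_pos (by positivity) s)).ne')
  obtain ⟨w, ⟨hwV, hwε⟩, -, l, -, rfl⟩ := mem_closure_iff_nhds.1 (hy.2 hx.2) _
    (inter_mem (hcont (hVopen.mem_nhds hdV)) (Metric.ball_mem_nhds x (half_pos hε)))
  have hball : Metric.closedBall w d ⊆ O := by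
    refine (Metric.closedBall_subset_ball' ?_).trans hεO
    have := Metric.mem_ball.1 hwε
    linarith
  have hle : wordRatio r l ≤ 1 :=
    (wordRatio_le_pow (fun i => (hr i).1) zero_le_one (fun i => (hr i).2.le) l).trans_eq
      (one_pow _)
  have hpos := wordRatio_pos (fun i => (hr i).1) l
  refine ⟨wordRatio r l * d, hδT ⟨mul_pos hpos hd0, ?_⟩, hVU ?_⟩
  · exact (mul_le_of_le_one_left hd0.le hle).trans_lt hdδ
  · rw [sdens_wordMap (fun i => (hr i).1) hsim hinv hO hOmap hdisj l hd0 hball]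
    exact hwV

end Density

/-- under the SOSC, `μ(E ∖ Ê) = 0`, `Ê ⊆ O`, and for every `y ∈ Ê`,
`Spec(μ, y) = Spec(μ, Ê) = Spec(μ, O ∩ E)`. -/
theorem stmt10 {n m : ℕ} (hn : 1 ≤ n) (hm : 2 ≤ m)
    (f : Fin m → EuclideanSpace ℝ (Fin n) → EuclideanSpace ℝ (Fin n))
    (r : Fin m → ℝ) (hr : ∀ i, r i ∈ Set.Ioo (0 : ℝ) 1)
    (hsim : ∀ i, IsSimilarityRatio (f i) (r i))
    (E : Set (EuclideanSpace ℝ (Fin n))) (hEcomp : IsCompact E) (hEne : E.Nonempty)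
    (hEattr : E = ⋃ i, f i '' E)
    (O : Set (EuclideanSpace ℝ (Fin n))) (hOopen : IsOpen O) (hOne : O.Nonempty)
    (hOmap : ∀ i, f i '' O ⊆ O)
    (hOdisj : ∀ i j, i ≠ j → Disjoint (f i '' O) (f j '' O))
    (hOE : (O ∩ E).Nonempty)
    (s : ℝ) (hs : ∑ i, (r i) ^ s = 1)
    (μ : Measure (EuclideanSpace ℝ (Fin n))) (hprob : IsProbabilityMeasure μ)
    (hsupp : μ Eᶜ = 0)
    (hinv : μ = ∑ i, ENNReal.ofReal ((r i) ^ s) • μ.map (f i))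
    (hfront : μ (frontier O) = 0)
    (hsph : ∀ (z : EuclideanSpace ℝ (Fin n)) (ρ : ℝ), μ (Metric.sphere z ρ) = 0) :
    μ (E \ denseOrbitSet f E) = 0 ∧
    denseOrbitSet f E ⊆ O ∧
    ∀ y ∈ denseOrbitSet f E,
      (specAt μ s y = ⋃ x ∈ denseOrbitSet f E, specAt μ s x) ∧
      (specAt μ s y = ⋃ x ∈ O ∩ E, specAt μ s x) := by
  have hr0 : ∀ i, 0 < r i := fun i => (hr i).1
  have hp : ∀ i, ENNReal.ofReal (r i ^ s) ≠ 0 := fun i =>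
    (ENNReal.ofReal_pos.2 (Real.rpow_pos_of_pos (hr0 i) s)).ne'
  have hp1 : ∑ i, ENNReal.ofReal (r i ^ s) = 1 := by
    rw [← ENNReal.ofReal_sum_of_nonneg fun i _ => Real.rpow_nonneg (hr0 i).le s, hs,
      ENNReal.ofReal_one]
  have hfull := measure_diff_denseOrbitSet hr hsim hEcomp hEattr hp hp1 hsupp hinv
  have hsub : denseOrbitSet f E ⊆ O := denseOrbitSet_subset hOopen hOmap hOE
  have hO : μ Oᶜ = 0 := by
    refine measure_mono_null (fun x hx => ?_) (measure_union_null hfull hsupp)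
    by_cases hxE : x ∈ E
    · exact Or.inl ⟨hxE, fun h => hx (hsub h)⟩
    · exact Or.inr hxE
  refine ⟨hfull, hsub, fun y hy => ?_⟩
  have hspec : ∀ x ∈ O ∩ E, specAt μ s x ⊆ specAt μ s y := fun x hx =>
    specAt_subset_of_mem_denseOrbitSet hr hsim hinv hO hOopen hOmap hOdisj hsph hx hy
  have hsub' : denseOrbitSet f E ⊆ O ∩ E := fun x hx => ⟨hsub hx, hx.1⟩
  exact ⟨(Set.subset_biUnion_of_mem (u := specAt μ s) hy).antisymm
      (Set.iUnion₂_subset fun x hx => hspec x (hsub' hx)),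
    (Set.subset_biUnion_of_mem (u := specAt μ s) (hsub' hy)).antisymm
      (Set.iUnion₂_subset hspec)⟩
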